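/- Let F be a field and let S be a cancellative semigroup such that the semigroup algebra FS is a centrally essential ring, and let Q be a classical right ring of fractions of FS. Then every element ρ of the center Z(Q) can be written as ρ = η·ε⁻¹ where η, ε ∈ Z(FS) and ε is a non-zero-divisor of FS. -/

import Mathlib

/-- A (not necessarily unital) ring `R` is centrally essential if for every element `a`
not lying in the center, there exist nonzero central elements `x, y` with `a * x = y`. -/
def IsCentrallyEssential (R : Type*) [NonUnitalNonAssocSemiring R] : Prop :=
  ∀ a : R, a ∉ Set.center R →
    ∃ x y : R, x ∈ Set.center R ∧ y ∈ Set.center R ∧ x ≠ 0 ∧ y ≠ 0 ∧ a * x = y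

/-- An element `r` is a (two-sided) non-zero-divisor. -/
def IsNonZeroDivisor {R : Type*} [NonUnitalNonAssocSemiring R] (r : R) : Prop :=
  (∀ x : R, r * x = 0 → x = 0) ∧ (∀ x : R, x * r = 0 → x = 0)

/-- `Q` (together with the injective ring homomorphism `φ : R → Q`) is a classical right
ring of fractions of `R`: every non-zero-divisor of `R` becomes invertible in `Q`, and
every element of `Q` has the form `φ a * (φ b)⁻¹` with `b` a non-zero-divisor of `R`. -/
structure IsClassicalRightRingOfFractions (R : Type*) [NonUnitalNonAssocSemiring R]
    (Q : Type*) [Ring Q] (φ : R →ₙ+* Q) : Prop where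
  inj : Function.Injective φ
  isUnit : ∀ b : R, IsNonZeroDivisor b → IsUnit (φ b)
  num_denom : ∀ q : Q, ∃ a b : R, IsNonZeroDivisor b ∧ q * φ b = φ a

/-- Every commutative group is torsion over some subgroup with unique products. -/
theorem CommGroup.exists_uniqueProds_subgroup (Z : Type*) [CommGroup Z] :
    ∃ A : Subgroup Z, UniqueProds A ∧ ∀ z : Z, ∃ n : ℕ, 0 < n ∧ z ^ n ∈ A := by
  obtain ⟨s, hs, hmax⟩ := exists_maximal_linearIndepOn ℤ (id : Additive Z → Additive Z)
  rw [Set.image_eq_range] at hmax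
  let B : AddSubgroup (Additive Z) :=
    (Submodule.span ℤ (Set.range fun x : s ↦ id (x : Additive Z))).toAddSubgroup
  have hB : UniqueSums B :=
    UniqueSums.of_injective_addHom hs.linearIndependent.repr.toAddMonoidHom.toAddHom
      (LinearMap.ker_eq_bot.mp hs.linearIndependent.repr_ker) inferInstance
  have hpow (z : Additive Z) : ∃ n : ℕ, 0 < n ∧ n • z ∈ B := by
    by_cases hz : z ∈ s
    · exact ⟨1, one_pos, (one_nsmul z).symm ▸ Submodule.subset_span ⟨⟨z, hz⟩, rfl⟩⟩
    · obtain ⟨a, ha, haz⟩ := hmax z hz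
      refine ⟨a.natAbs, Int.natAbs_pos.mpr ha, ?_⟩
      replace haz : a • z ∈ B := haz
      rw [← natCast_zsmul]
      rcases Int.natAbs_eq a with h | h
      · rwa [← h]
      · have : ((a.natAbs : ℕ) : ℤ) = -a := by omega
        rw [this, neg_smul]
        exact B.neg_mem haz
  refine ⟨AddSubgroup.toSubgroup' B, ?_, fun z ↦ hpow (Additive.ofMul z)⟩
  exact inferInstanceAs (UniqueProds (Multiplicative B))

open scoped IsMulCommutative in
/-- In a finitely generated group with finite conjugacy classes, a central subgroup containing
a power of every element has finite index. -/
theorem Subgroup.finiteIndex_of_le_center_of_pow_mem {G : Type*} [Group G] [Group.FG G]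
    (hG : ∀ g : G, (Subgroup.centralizer {g}).FiniteIndex) (B : Subgroup G)
    (hB : B ≤ Subgroup.center G) (hpow : ∀ g : G, ∃ n : ℕ, 0 < n ∧ g ^ n ∈ B) :
    B.FiniteIndex := by
  have hcenter : (Subgroup.center G).FiniteIndex := by
    obtain ⟨s, hs⟩ := (Group.fg_def.mp ‹Group.FG G›)
    have := Subgroup.finiteIndex_iInf' (s := s) (fun g : G ↦ Subgroup.centralizer {g})
      fun g _ ↦ hG g
    refine Subgroup.finiteIndex_of_le (H := ⨅ g ∈ s, Subgroup.centralizer {g}) ?_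
    intro x hx
    simp only [Subgroup.mem_iInf, Subgroup.mem_centralizer_singleton_iff] at hx
    rw [← Subgroup.centralizer_univ, ← Subgroup.coe_top, ← hs, Subgroup.centralizer_closure]
    exact Subgroup.mem_centralizer_iff.mpr fun g hg ↦ (hx g hg).symm
  have : Finite (Subgroup.center G ⧸ B.subgroupOf (Subgroup.center G)) := by
    refine CommGroup.finite_of_fg_isMulTorsion _ fun q ↦ ?_
    induction q using QuotientGroup.induction_on with
    | H z =>
      obtain ⟨n, hn, hz⟩ := hpow z
      refine isOfFinOrder_iff_pow_eq_one.mpr ⟨n, hn, ?_⟩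
      rw [← QuotientGroup.mk_pow, QuotientGroup.eq_one_iff]
      simpa [Subgroup.mem_subgroupOf] using hz
  constructor
  rw [← Subgroup.relIndex_mul_index hB]
  refine mul_ne_zero ?_ hcenter.index_ne_zero
  exact (Subgroup.finiteIndex_of_finite_quotient (H := B.subgroupOf _)).index_ne_zero

/-- In a group with finite conjugacy classes, every element has a central power. -/
theorem exists_pow_mem_center {G : Type*} [Group G]
    (hG : ∀ g : G, (Subgroup.centralizer {g}).FiniteIndex) (g : G) :
    ∃ n : ℕ, 0 < n ∧ g ^ n ∈ Subgroup.center G := by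
  have := hG g
  have hK := Subgroup.finiteIndex_iInf
    (f := fun q : G ⧸ Subgroup.centralizer {g} ↦ Subgroup.centralizer {q.out}) fun q ↦ hG _
  obtain ⟨n, hn, -, hmem⟩ := Subgroup.exists_pow_mem_of_index_ne_zero hK.index_ne_zero g
  refine ⟨n, hn, Subgroup.mem_center_iff.mpr fun h ↦ ?_⟩
  obtain ⟨c, hc⟩ := QuotientGroup.mk_out_eq_mul (Subgroup.centralizer {g}) h
  have h1 : Commute (g ^ n) (QuotientGroup.mk h : G ⧸ Subgroup.centralizer {g}).out :=
    (Subgroup.mem_centralizer_singleton_iff.mp (Subgroup.mem_iInf.mp hmem _))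
  have h2 : Commute (g ^ n) c :=
    Commute.pow_left (Subgroup.mem_centralizer_singleton_iff.mp c.2).symm n
  rw [hc] at h1
  have := h1.mul_right h2.inv_right
  rw [mul_inv_cancel_right] at this
  exact this.symm

namespace MonoidAlgebra

variable {F : Type*} [Field F] {A G : Type*} [CommGroup A] [Group G]

theorem eq_zero_of_mapDomain_mul_eq_zero [UniqueProds A] {j : A →* G}
    (hj : Function.Injective j) {d : MonoidAlgebra F A} (hd : d ≠ 0) {x : MonoidAlgebra F G}
    (hx : mapDomain j d * x = 0) : x = 0 := by
  classical
  by_contra hx0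
  obtain ⟨x₀, hx₀⟩ := Finsupp.support_nonempty_iff.mpr (mt coeff_eq_zero.mp hx0)
  have hinj : Function.Injective fun a : A ↦ j a * x₀ := fun a b hab ↦ hj (mul_right_cancel hab)
  let X : Finset A := x.coeff.support.preimage (fun a ↦ j a * x₀) hinj.injOn
  have hX : X.Nonempty := ⟨1, by simpa [X] using hx₀⟩
  obtain ⟨a₀, ha₀, a₁, ha₁, huniq⟩ := UniqueProds.uniqueMul_of_nonempty
    (Finsupp.support_nonempty_iff.mpr (mt coeff_eq_zero.mp hd)) hX
  have hcoeff (a : A) : (mapDomain j d).coeff (j a) = d.coeff a :=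
    Finsupp.mapDomain_apply hj d.coeff a
  have hunique : UniqueMul (mapDomain j d).coeff.support x.coeff.support (j a₀) (j a₁ * x₀) := by
    intro a y ha hy hay
    obtain ⟨a', ha', rfl⟩ := Finset.mem_image.mp (Finsupp.mapDomain_support ha)
    have hy' : y = j (a'⁻¹ * (a₀ * a₁)) * x₀ := by
      rw [map_mul, map_inv, map_mul, mul_assoc, mul_assoc, ← hay, inv_mul_cancel_left]
    obtain ⟨h1, h2⟩ := huniq ha' (b := a'⁻¹ * (a₀ * a₁))
      (Finset.mem_preimage.mpr (hy' ▸ hy)) (mul_inv_cancel_left _ _)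
    exact ⟨by rw [h1], by rw [hy', h2]⟩
  have := coeff_mul_mul_of_uniqueMul hunique
  rw [hx, hcoeff] at this
  exact mul_ne_zero (Finsupp.mem_support_iff.mp ha₀)
    (Finsupp.mem_support_iff.mp (Finset.mem_preimage.mp ha₁)) (by simpa using this.symm)

open scoped IsMulCommutative in
/-- In the group algebra of a group with finite conjugacy classes, every regular element has
a regular central right multiple. -/
theorem exists_mul_mem_center (hG : ∀ g : G, (Subgroup.centralizer {g}).FiniteIndex)
    {b : MonoidAlgebra F G} (hb : b ∈ nonZeroDivisors (MonoidAlgebra F G)) :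
    ∃ c : MonoidAlgebra F G, (∀ x, Commute (b * c) x) ∧ ∀ x, b * c * x = 0 → x = 0 := by
  classical
  obtain ⟨A, hA, hpowA⟩ := CommGroup.exists_uniqueProds_subgroup (Subgroup.center G)
  let j : A →* G := (Subgroup.center G).subtype.comp A.subtype
  have hj : Function.Injective j := Subtype.val_injective.comp Subtype.val_injective
  have hjc (a : A) (g : G) : Commute (j a) g := (Subgroup.mem_center_iff.mp a.1.2 g).symm
  have hcomm (d : MonoidAlgebra F A) (x : MonoidAlgebra F G) :
      Commute (mapDomainRingHom F j d) x := by
    induction d using MonoidAlgebra.induction_linear with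
    | zero => simp
    | add d e hd he => rw [map_add]; exact hd.add_left he
    | single a r =>
      rw [mapDomainRingHom_apply, mapDomain_single]
      exact single_commute (fun g ↦ hjc a g) (fun r' ↦ Commute.all _ _) x
  let : Algebra (MonoidAlgebra F A) (MonoidAlgebra F G) :=
    (mapDomainRingHom F j).toAlgebra' hcomm
  have hsmul (d : MonoidAlgebra F A) (x : MonoidAlgebra F G) : d • x = mapDomain j d * x := rfl
  let H : Subgroup G := Subgroup.closure (b.coeff.support : Set G)
  have : Group.FG H := Group.closure_finset_fg _
  have hfin : (j.range.subgroupOf H).FiniteIndex := by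
    refine Subgroup.finiteIndex_of_le_center_of_pow_mem (fun h ↦ ?_) _ ?_ ?_
    · have := hG h
      refine Subgroup.finiteIndex_of_le (H := (Subgroup.centralizer {(h : G)}).subgroupOf H) ?_
      intro x hx
      rw [Subgroup.mem_subgroupOf, Subgroup.mem_centralizer_singleton_iff] at hx
      exact Subgroup.mem_centralizer_singleton_iff.mpr (Subtype.ext hx)
    · rintro h ⟨a, ha⟩
      refine Subgroup.mem_center_iff.mpr fun g ↦ Subtype.ext ?_
      have := (hjc a g).symm.eq
      rw [ha] at this
      exact this
    · intro h
      obtain ⟨m, hm, hm'⟩ := exists_pow_mem_center hG h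
      obtain ⟨n, hn, hn'⟩ := hpowA ⟨_, hm'⟩
      refine ⟨m * n, Nat.mul_pos hm hn, ⟨⟨_, hn'⟩, ?_⟩⟩
      simp [j, pow_mul]
  have hclosure : (Submonoid.closure (of F G '' (H : Set G)) : Set (MonoidAlgebra F G)) =
      of F G '' (H : Set G) := by
    have : of F G '' (H : Set G) = (H.toSubmonoid.map (of F G) : Set _) := rfl
    rw [this, Submonoid.closure_eq]
  let M := Algebra.adjoin (MonoidAlgebra F A) (of F G '' (H : Set G))
  have hM : M.toSubmodule = Submodule.span (MonoidAlgebra F A) (of F G '' (H : Set G)) :=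
    (Algebra.adjoin_eq_span _ _).trans (by rw [hclosure])
  have hfg : M.toSubmodule.FG := by
    have := Fintype.ofFinite (H ⧸ j.range.subgroupOf H)
    rw [Submodule.fg_def]
    refine ⟨Set.range fun q : H ⧸ j.range.subgroupOf H ↦ of F G q.out, Set.finite_range _, ?_⟩
    rw [hM]
    refine le_antisymm (Submodule.span_mono ?_) (Submodule.span_le.mpr ?_)
    · rintro _ ⟨q, rfl⟩
      exact ⟨_, q.out.2, rfl⟩
    · rintro _ ⟨h, hh, rfl⟩
      obtain ⟨⟨c, a, ha⟩, hc⟩ :=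
        QuotientGroup.mk_out_eq_mul (j.range.subgroupOf H) ⟨h, hh⟩
      have heq : of F G h = single a⁻¹ (1 : F) •
          of F G (QuotientGroup.mk ⟨h, hh⟩ : H ⧸ j.range.subgroupOf H).out := by
        replace ha : j a = c := ha
        rw [hsmul, mapDomain_single, of_apply, of_apply, single_mul_single, hc]
        congr 1
        · simp only [Subgroup.coe_mul, ← ha, map_inv]
          rw [← (hjc a h).eq, inv_mul_cancel_left]
        · simp
      rw [SetLike.mem_coe, heq]
      exact Submodule.smul_mem _ _ (Submodule.subset_span ⟨_, rfl⟩)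
  have hbM : b ∈ M := by
    rw [← b.sum_coeff_single]
    refine Subalgebra.sum_mem _ fun g hg ↦ ?_
    have : single g (b.coeff g) = single (1 : A) (b.coeff g) • of F G g := by
      rw [hsmul, mapDomain_single, of_apply, single_mul_single]
      simp
    rw [this]
    exact Subalgebra.smul_mem _ (Algebra.subset_adjoin
      (Set.mem_image_of_mem _ (Subgroup.subset_closure hg))) _
  obtain ⟨c, -, d, hd, hbc⟩ :=
    (IsIntegral.of_mem_of_fg M hfg b hbM).isAlgebraic.exists_nonzero_eq_adjoin_mul hb
  replace hbc : b * c = mapDomainRingHom F j d := hbc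
  refine ⟨c, fun x ↦ hbc ▸ hcomm d x, fun x hx ↦ ?_⟩
  rw [hbc] at hx
  exact eq_zero_of_mapDomain_mul_eq_zero hj hd hx

end MonoidAlgebra

namespace MonoidAlgebra

variable {F : Type*} [Field F] {G : Type*} [Group G]

/-- Elements of the support of a central element of a group algebra have finitely many
conjugates. -/
theorem finiteIndex_centralizer_of_mem_support {s : Set G} (hs : Subgroup.closure s = ⊤)
    {x : MonoidAlgebra F G} (hx : ∀ g ∈ s, Commute (single g 1) x) {t : G}
    (ht : t ∈ x.coeff.support) : (Subgroup.centralizer {t}).FiniteIndex := by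
  have hcomm (g : G) : Commute (single g 1) x := by
    have hg : g ∈ Subgroup.closure s := hs ▸ Subgroup.mem_top g
    induction hg using Subgroup.closure_induction with
    | mem g hg => exact hx g hg
    | one => exact Commute.one_left x
    | mul g h _ _ hg hh => simpa using hg.mul_left hh
    | inv g _ hg =>
      have h1 : single g⁻¹ (1 : F) * single g 1 = 1 := by simp [one_def]
      have h2 : single g (1 : F) * single g⁻¹ 1 = 1 := by simp [one_def]
      calc single g⁻¹ 1 * x = single g⁻¹ 1 * (x * single g 1) * single g⁻¹ 1 := by
            rw [mul_assoc, mul_assoc, h2, mul_one]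
        _ = x * single g⁻¹ 1 := by rw [← hg.eq, ← mul_assoc, h1, one_mul]
  have horbit : MulAction.orbit (ConjAct G) t ⊆ x.coeff.support := by
    rintro _ ⟨g, rfl⟩
    induction g using ConjAct.rec with
    | _ g =>
    have := congr_arg (fun y ↦ y.coeff (g * t)) (hcomm g).eq
    rw [Finset.mem_coe, Finsupp.mem_support_iff]
    simp only [coeff_single_mul_apply, coeff_mul_single_apply, inv_mul_cancel_left, one_mul,
      mul_one] at this
    simpa only [ConjAct.smul_def, ConjAct.ofConjAct_toConjAct, ← this] using
      Finsupp.mem_support_iff.mp ht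
  have hfin := x.coeff.support.finite_toSet.subset horbit
  have := MulAction.index_stabilizer (ConjAct G) t
  rw [ConjAct.stabilizer_eq_centralizer] at this
  constructor
  change (Subgroup.centralizer {ConjAct.toConjAct t}).index ≠ 0
  rw [this]
  exact ((Set.ncard_pos hfin).mpr (MulAction.nonempty_orbit t)).ne'

variable {S : Type*} [Semigroup S] {i : S →ₙ* G}

/-- A group generated by a semigroup with centrally essential semigroup algebra has finite
conjugacy classes. -/
theorem finiteIndex_centralizer_of_isCentrallyEssential (hi : Function.Injective i)
    (hclosure : Subgroup.closure (Set.range i) = ⊤)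
    (h : IsCentrallyEssential (MonoidAlgebra F S)) (g : G) :
    (Subgroup.centralizer {g}).FiniteIndex := by
  have hsupp {x : MonoidAlgebra F S} (hx : x ∈ Set.center (MonoidAlgebra F S)) {t : G}
      (ht : t ∈ (mapDomain i x).coeff.support) : (Subgroup.centralizer {t}).FiniteIndex := by
    refine finiteIndex_centralizer_of_mem_support hclosure ?_ ht
    rintro _ ⟨s, rfl⟩
    have := Semigroup.mem_center_iff.mp hx (single s 1)
    replace this := congr_arg (mapDomain i) this
    rwa [mapDomain_mul, mapDomain_mul, mapDomain_single] at this
  have hmul {a b : G} (ha : (Subgroup.centralizer {a}).FiniteIndex)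
      (hb : (Subgroup.centralizer {b}).FiniteIndex) :
      (Subgroup.centralizer {a * b}).FiniteIndex := by
    refine Subgroup.finiteIndex_of_le
      (H := Subgroup.centralizer {a} ⊓ Subgroup.centralizer {b}) fun c hc ↦ ?_
    rw [Subgroup.mem_inf, Subgroup.mem_centralizer_singleton_iff,
      Subgroup.mem_centralizer_singleton_iff] at hc
    exact Subgroup.mem_centralizer_singleton_iff.mpr (Commute.mul_right hc.1 hc.2)
  have hinv {a : G} (ha : (Subgroup.centralizer {a}).FiniteIndex) :
      (Subgroup.centralizer {a⁻¹}).FiniteIndex := by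
    refine Subgroup.finiteIndex_of_le (H := Subgroup.centralizer {a}) fun c hc ↦ ?_
    rw [Subgroup.mem_centralizer_singleton_iff] at hc
    exact Subgroup.mem_centralizer_singleton_iff.mpr (Commute.inv_right hc)
  have hg : g ∈ Subgroup.closure (Set.range i) := hclosure ▸ Subgroup.mem_top g
  induction hg using Subgroup.closure_induction with
  | mem g hg =>
    obtain ⟨s, rfl⟩ := hg
    by_cases hs : single s (1 : F) ∈ Set.center (MonoidAlgebra F S)
    · exact hsupp hs (by simp [mapDomain_single])
    · obtain ⟨x, y, hx, hy, hx0, -, hxy⟩ := h _ hs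
      have hx' : mapDomain i x ≠ 0 := fun h0 ↦
        hx0 (mapDomain_injective hi (h0.trans (mapDomain_zero _).symm))
      obtain ⟨t, ht⟩ := Finsupp.support_nonempty_iff.mpr (mt coeff_eq_zero.mp hx')
      have hst : i s * t ∈ (mapDomain i y).coeff.support := by
        rw [← hxy, mapDomain_mul, mapDomain_single, Finsupp.mem_support_iff,
          coeff_single_mul_apply]
        simpa using ht
      simpa using hmul (hsupp hy hst) (hinv (hsupp hx ht))
  | one => exact Subgroup.finiteIndex_of_le (H := ⊤) fun c _ ↦
      Subgroup.mem_centralizer_singleton_iff.mpr (Commute.one_right c)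
  | mul a b _ _ ha hb => exact hmul ha hb
  | inv a _ ha => exact hinv ha

/-- In a group with finite conjugacy classes generated by a semigroup, all elements are fractions
with a common central denominator in the semigroup. -/
theorem exists_mul_central_eq [Nonempty S]
    (hclosure : Subgroup.closure (Set.range i) = ⊤)
    (hG : ∀ g : G, (Subgroup.centralizer {g}).FiniteIndex) (g : G) :
    ∃ s z : S, i z ∈ Subgroup.center G ∧ g * i z = i s := by
  have hpow (s : S) (n : ℕ) : ∃ t, i t = i s ^ (n + 1) := by
    induction n with
    | zero => exact ⟨s, by simp⟩
    | succ n ih =>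
      obtain ⟨t, ht⟩ := ih
      exact ⟨t * s, by rw [map_mul, ht, pow_succ _ (n + 1)]⟩
  have hcentral (s : S) : ∃ n, i s ^ (n + 1) ∈ Subgroup.center G := by
    obtain ⟨n, hn, hmem⟩ := exists_pow_mem_center hG (i s)
    exact ⟨n - 1, by rwa [Nat.sub_add_cancel hn]⟩
  have hg : g ∈ Subgroup.closure (Set.range i) := hclosure ▸ Subgroup.mem_top g
  induction hg using Subgroup.closure_induction with
  | mem g hg =>
    obtain ⟨s, rfl⟩ := hg
    obtain ⟨n, hn⟩ := hcentral s
    obtain ⟨z, hz⟩ := hpow s n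
    exact ⟨s * z, z, hz ▸ hn, (map_mul i s z).symm⟩
  | one =>
    obtain ⟨n, hn⟩ := hcentral (Classical.arbitrary S)
    obtain ⟨z, hz⟩ := hpow (Classical.arbitrary S) n
    exact ⟨z, z, hz ▸ hn, one_mul _⟩
  | mul a b _ _ ha hb =>
    obtain ⟨s, z, hz, hs⟩ := ha
    obtain ⟨t, w, hw, ht⟩ := hb
    refine ⟨s * t, z * w, map_mul i z w ▸ mul_mem hz hw, ?_⟩
    rw [map_mul, map_mul, ← hs, ← ht, mul_assoc, mul_assoc, ← mul_assoc b,
      Subgroup.mem_center_iff.mp hz b, mul_assoc]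
  | inv a _ ha =>
    obtain ⟨s, z, hz, hs⟩ := ha
    obtain ⟨n, hn⟩ := hcentral s
    obtain ⟨w, hw⟩ := hpow s n
    obtain ⟨t, ht⟩ : ∃ t, i t = i z * i s ^ n := by
      cases n with
      | zero => exact ⟨z, by simp⟩
      | succ n =>
        obtain ⟨t, ht⟩ := hpow s n
        exact ⟨z * t, by rw [map_mul, ht]⟩
    refine ⟨t, w, hw ▸ hn, ?_⟩
    rw [ht, hw, pow_succ', ← mul_assoc, ← hs, inv_mul_cancel_left]

/-- If a cancellative semigroup embeds in a group that it generates and its semigroup algebra is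
centrally essential, then regular elements of the semigroup algebra have regular central right
multiples. -/
theorem exists_mul_mem_center_of_isCentrallyEssential [Nonempty S] (hi : Function.Injective i)
    (hclosure : Subgroup.closure (Set.range i) = ⊤)
    (h : IsCentrallyEssential (MonoidAlgebra F S)) {b : MonoidAlgebra F S}
    (hb : IsNonZeroDivisor b) :
    ∃ c, b * c ∈ Set.center (MonoidAlgebra F S) ∧ IsNonZeroDivisor (b * c) := by
  have hG := finiteIndex_centralizer_of_isCentrallyEssential hi hclosure h
  have hinj : Function.Injective (mapDomain (R := F) i) := mapDomain_injective hi
  have hsingle {g : G} (hg : g ∈ Subgroup.center G) (x : MonoidAlgebra F G) :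
      Commute (single g 1) x :=
    single_commute (fun k ↦ (Subgroup.mem_center_iff.mp hg k).symm) (fun r ↦ Commute.all _ _) x
  have hcancel {g : G} {x : MonoidAlgebra F G} (hx : x * single g 1 = 0) : x = 0 := by
    have := congr_arg (· * single g⁻¹ (1 : F)) hx
    simpa [mul_assoc, ← one_def] using this
  have hden (x : MonoidAlgebra F G) : ∃ (r : MonoidAlgebra F S) (z : S),
      i z ∈ Subgroup.center G ∧ x * single (i z) 1 = mapDomain i r := by
    induction x using MonoidAlgebra.induction_linear with
    | zero =>
      obtain ⟨-, z, hz, -⟩ := exists_mul_central_eq hclosure hG 1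
      exact ⟨0, z, hz, by simp⟩
    | add x y hx hy =>
      obtain ⟨r, z, hz, hr⟩ := hx
      obtain ⟨t, w, hw, ht⟩ := hy
      refine ⟨r * single w 1 + t * single z 1, z * w, map_mul i z w ▸ mul_mem hz hw, ?_⟩
      rw [mapDomain_add, mapDomain_mul, mapDomain_mul, ← hr, ← ht, mapDomain_single,
        mapDomain_single, mul_assoc, mul_assoc, (hsingle hw (single (i z) 1)).eq,
        single_mul_single, add_mul, map_mul, mul_one]
    | single g r =>
      obtain ⟨s, z, hz, hs⟩ := exists_mul_central_eq hclosure hG g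
      exact ⟨single s r, z, hz, by rw [single_mul_single, hs, mul_one, mapDomain_single]⟩
  have hb' : mapDomain i b ∈ nonZeroDivisors (MonoidAlgebra F G) := by
    refine mem_nonZeroDivisors_iff.mpr ⟨fun x hx ↦ ?_, fun x hx ↦ ?_⟩ <;>
      obtain ⟨r, z, hz, hr⟩ := hden x <;> refine hcancel (g := i z) ?_ <;> rw [hr]
    · have : mapDomain i (b * r) = mapDomain i 0 := by
        rw [mapDomain_mul, ← hr, ← mul_assoc, hx, zero_mul, mapDomain_zero]
      rw [hb.1 r (hinj this), mapDomain_zero]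
    · have : mapDomain i (r * b) = mapDomain i 0 := by
        rw [mapDomain_mul, ← hr, mul_assoc, (hsingle hz _).eq, ← mul_assoc, hx, zero_mul,
          mapDomain_zero]
      rw [hb.2 r (hinj this), mapDomain_zero]
  obtain ⟨c, hc, hreg⟩ := exists_mul_mem_center hG hb'
  obtain ⟨r, z, hz, hr⟩ := hden c
  have hmap : mapDomain i (b * r) = mapDomain i b * c * single (i z) 1 := by
    rw [mapDomain_mul, ← hr, mul_assoc]
  have hcomm (x : MonoidAlgebra F G) : Commute (mapDomain i (b * r)) x :=
    hmap ▸ (hc x).mul_left (hsingle hz x)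
  have hcenter (x : MonoidAlgebra F S) : x * (b * r) = b * r * x :=
    hinj (by rw [mapDomain_mul _ x, mapDomain_mul _ _ x, (hcomm _).eq])
  have hzero (x : MonoidAlgebra F S) (hx : b * r * x = 0) : x = 0 := by
    refine hinj ((hcancel (g := i z) (hreg _ ?_)).trans (mapDomain_zero _).symm)
    rw [← (hsingle hz _).eq, ← mul_assoc, ← hmap, ← mapDomain_mul, hx, mapDomain_zero]
  exact ⟨r, Semigroup.mem_center_iff.mpr hcenter, hzero, fun x hx ↦ hzero x (hcenter x ▸ hx)⟩

theorem isNonZeroDivisor_single [IsCancelMul S] (s : S) :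
    IsNonZeroDivisor (single s (1 : F)) := by
  constructor
  · intro x hx
    ext t
    have := coeff_single_mul_eq_mul_coeff (x := x) (r := (1 : F)) (m := s) (m₁ := s * t) t
      fun t' _ ↦ mul_right_inj s
    simpa [hx] using this.symm
  · intro x hx
    ext t
    have := coeff_mul_single_eq_coeff_mul (x := x) (r := (1 : F)) (m := s) (m₁ := t * s) t
      fun t' _ ↦ mul_left_inj s
    simpa [hx] using this.symm

end MonoidAlgebra

/-- If `S` is a cancellative semigroup, `F[S]` is centrally essential and `Q` is a
classical right ring of fractions of `F[S]`, then every element `ρ` of `Z(Q)` can be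
written as `ρ = η * ε⁻¹` (i.e., `ρ * ε = η`) with `η, ε` central elements of `F[S]` and
`ε` a non-zero-divisor of `F[S]`. -/
theorem stmt12 (F : Type*) [Field F] (S : Type*) [Semigroup S] [IsCancelMul S]
    (Q : Type*) [Ring Q] (φ : MonoidAlgebra F S →ₙ+* Q)
    (hQ : IsClassicalRightRingOfFractions (MonoidAlgebra F S) Q φ)
    (h : IsCentrallyEssential (MonoidAlgebra F S)) :
    ∀ ρ ∈ Set.center Q, ∃ η ε : MonoidAlgebra F S,
      η ∈ Set.center (MonoidAlgebra F S) ∧ ε ∈ Set.center (MonoidAlgebra F S) ∧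
      IsNonZeroDivisor ε ∧ ρ * φ ε = φ η := by
  intro ρ hρ
  replace hρ := Semigroup.mem_center_iff.mp hρ
  obtain ⟨a, b, hb, hab⟩ := hQ.num_denom ρ
  obtain ⟨c, hc, hreg⟩ :
      ∃ c, b * c ∈ Set.center (MonoidAlgebra F S) ∧ IsNonZeroDivisor (b * c) := by
    cases isEmpty_or_nonempty S with
    | inl hS =>
      have hzero (x : MonoidAlgebra F S) : x = 0 := by ext s; exact hS.elim s
      refine ⟨0, ?_, fun x _ ↦ hzero x, fun x _ ↦ hzero x⟩
      rw [mul_zero]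
      exact Set.zero_mem_center
    | inr hS =>
      have hunit (s : S) := hQ.isUnit _ (MonoidAlgebra.isNonZeroDivisor_single (F := F) s)
      let G : Subgroup Qˣ := Subgroup.closure (Set.range fun s ↦ (hunit s).unit)
      let i : S →ₙ* G :=
        { toFun := fun s ↦ ⟨(hunit s).unit, Subgroup.subset_closure ⟨s, rfl⟩⟩
          map_mul' := fun s t ↦ Subtype.ext <| Units.ext <| by simp [← map_mul] }
      have hi : Function.Injective i := fun s t hst ↦ by
        have h1 : φ (.single s 1) = φ (.single t 1) :=
          congr_arg (fun g : G ↦ ((g : Qˣ) : Q)) hst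
        exact MonoidAlgebra.single_left_injective one_ne_zero (hQ.inj h1)
      have hclosure : Subgroup.closure (Set.range i) = ⊤ := by
        rw [← Subgroup.closure_closure_coe_preimage
          (k := Set.range fun s ↦ (hunit s).unit)]
        congr 1
        ext g
        exact exists_congr fun s ↦ Subtype.ext_iff
      exact MonoidAlgebra.exists_mul_mem_center_of_isCentrallyEssential hi hclosure h hb
  have hη : ρ * φ (b * c) = φ (a * c) := by rw [map_mul, map_mul, ← mul_assoc, hab]
  refine ⟨a * c, b * c, Semigroup.mem_center_iff.mpr fun x ↦ hQ.inj ?_, hc, hreg, hη⟩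
  rw [map_mul _ x, map_mul _ (a * c), ← hη, ← mul_assoc, hρ, mul_assoc, mul_assoc, ← map_mul,
    ← map_mul, Semigroup.mem_center_iff.mp hc]
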